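/- Let A be a finitely generated free abelian group. Then the canonical Hochschild 3-cocycle θ of the cohomology ring H^*(A) is a coboundary: for any choice of graded Z-linear sections s : H^*(A) → Ker(d) and q : Im(d) → C^*(A), there exists a graded Z-linear map a : H^*(A) ⊗ H^*(A) → H^*(A) of degree −1 such that for all homogeneous x, y, z ∈ H^*(A): θ(x,y,z) = (−1)^{|x|} x·a(y,z) − a(xy,z) + a(x,yz) − a(x,y)·z. Equivalently, the class [θ(A)] ∈ HH^3_gr(H^*(A), H^*(A)-bar[1]) is trivial. -/

import Mathlib

/-- `Qmap s q x y` is the cochain `q(x,y) := q(s(x)s(y) - s(xy))`. -/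
def Qmap {k C H : Type} [CommRing k] [Ring C] [Ring H] [Module k C] [Module k H]
    (s : H →ₗ[k] C) (q : C → C) (x y : H) : C :=
  q (s x * s y - s (x * y))

/-- `Theta s q i x y z` is the expression
`Θ(x,y,z) = (-1)^{|x|} s(x) q(y,z) - q(xy,z) + q(x,yz) - q(x,y) s(z)`,
where `i = |x|` is the degree of `x`. -/
def Theta {k C H : Type} [CommRing k] [Ring C] [Ring H] [Module k C] [Module k H]
    (s : H →ₗ[k] C) (q : C → C) (i : ℕ) (x y z : H) : C :=
  ((-1 : ℤ) ^ i) • (s x * Qmap s q y z) - Qmap s q (x * y) z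
    + Qmap s q x (y * z) - Qmap s q x y * s z

/-- The cup product on the standard (inhomogeneous bar) cochain complex of an abelian
group `A`: `(f·g)(a_1,…,a_{p+q}) = f(a_1,…,a_p) g(a_{p+1},…,a_{p+q})`. -/
def barCup (A : Type) (p q : ℕ) (f : (Fin p → A) → ℤ) (g : (Fin q → A) → ℤ) :
    (Fin (p + q) → A) → ℤ :=
  fun a => f (fun i => a (Fin.castAdd q i)) * g (fun j => a (Fin.natAdd p j))

/-- The differential of the standard (inhomogeneous bar) cochain complex of an abelian
group `A`:
`(df)(a_1,…,a_{l+1}) = f(a_2,…,a_{l+1}) + ∑_{i=1}^{l} (-1)^i f(a_1,…,a_i + a_{i+1},…,a_{l+1})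
  + (-1)^{l+1} f(a_1,…,a_l)`. -/
def barDiff (A : Type) [AddCommGroup A] (l : ℕ) (f : (Fin l → A) → ℤ) :
    (Fin (l + 1) → A) → ℤ :=
  fun a => f (fun i => a i.succ)
    + (∑ i ∈ Finset.range l, ((-1 : ℤ) ^ (i + 1)) *
        f (fun j => if (j : ℕ) < i then a j.castSucc
            else if (j : ℕ) = i then a j.castSucc + a j.succ
            else a j.succ))
    + ((-1 : ℤ) ^ (l + 1)) * f (fun j => a j.castSucc)

/-- The module `M` is generated by `p` elements. -/
def IsGeneratedBy (M : Type) [AddCommGroup M] (p : ℕ) : Prop :=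
  ∃ f : (Fin p → ℤ) →ₗ[ℤ] M, Function.Surjective f

theorem IsGeneratedBy.of_finite {M : Type} [AddCommGroup M] {ι : Type} [Fintype ι] {p : ℕ}
    (hp : Fintype.card ι = p) (f : (ι → ℤ) →ₗ[ℤ] M) (hf : Function.Surjective f) :
    IsGeneratedBy M p := by
  let e : Fin p ≃ ι := (Fintype.equivFinOfCardEq hp).symm
  exact ⟨f ∘ₗ (LinearEquiv.funCongrLeft ℤ ℤ e.symm).toLinearMap,
    hf.comp (LinearEquiv.funCongrLeft ℤ ℤ e.symm).surjective⟩

theorem IsGeneratedBy.of_surjective {M N : Type} [AddCommGroup M] [AddCommGroup N] {p : ℕ}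
    (h : IsGeneratedBy M p) (f : M →+ N) (hf : Function.Surjective f) : IsGeneratedBy N p := by
  obtain ⟨g, hg⟩ := h
  exact ⟨f.toIntLinearMap ∘ₗ g, hf.comp hg⟩

theorem IsGeneratedBy.submodule {M : Type} [AddCommGroup M] {p : ℕ}
    (h : IsGeneratedBy M p) (N : Submodule ℤ M) : IsGeneratedBy N p := by
  obtain ⟨f, hf⟩ := h
  obtain ⟨m, b⟩ := Submodule.basisOfPid (Pi.basisFun ℤ (Fin p)) (N.comap f)
  have hm : m ≤ p := by
    have h1 := Module.finrank_eq_card_basis b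
    have h2 := Submodule.finrank_le (N.comap f)
    simp only [Fintype.card_fin, Module.finrank_fin_fun] at h1 h2
    omega
  have hr : Function.Surjective (f.restrict (p := N.comap f) (q := N) fun _ hx ↦ hx) := by
    rintro ⟨y, hy⟩
    obtain ⟨x, rfl⟩ := hf y
    exact ⟨⟨x, hy⟩, rfl⟩
  let g : (Fin p → ℤ) →ₗ[ℤ] (Fin m → ℤ) := LinearMap.funLeft ℤ ℤ (Fin.castLE hm)
  have hg : Function.Surjective g :=
    LinearMap.funLeft_surjective_of_injective ℤ ℤ _ (Fin.castLE_injective hm)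
  exact ⟨f.restrict (p := N.comap f) (q := N) (fun _ hx ↦ hx) ∘ₗ b.equivFun.symm.toLinearMap ∘ₗ g,
    hr.comp (b.equivFun.symm.surjective.comp hg)⟩

theorem IsGeneratedBy.of_exact {M₁ M₂ M₃ : Type} [AddCommGroup M₁] [AddCommGroup M₂]
    [AddCommGroup M₃] {p₁ p₃ : ℕ} (h₁ : IsGeneratedBy M₁ p₁) (h₃ : IsGeneratedBy M₃ p₃)
    (f : M₁ →+ M₂) (g : M₂ →+ M₃) (hfg : Function.Exact f g) :
    IsGeneratedBy M₂ (p₁ + p₃) := by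
  obtain ⟨f, rfl⟩ : ∃ f' : M₁ →ₗ[ℤ] M₂, f'.toAddMonoidHom = f := ⟨f.toIntLinearMap, rfl⟩
  obtain ⟨g, rfl⟩ : ∃ g' : M₂ →ₗ[ℤ] M₃, g'.toAddMonoidHom = g := ⟨g.toIntLinearMap, rfl⟩
  obtain ⟨a, ha⟩ := h₁
  obtain ⟨b, hb⟩ := h₃.submodule (LinearMap.range g)
  obtain ⟨c, hc⟩ := Module.projective_lifting_property g.rangeRestrict b g.surjective_rangeRestrict
  refine IsGeneratedBy.of_finite (ι := Fin p₁ ⊕ Fin p₃) (by simp)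
    ((f ∘ₗ a).coprod c ∘ₗ (LinearEquiv.sumArrowLequivProdArrow _ _ ℤ ℤ).toLinearMap) ?_
  refine Function.Surjective.comp (g := (f ∘ₗ a).coprod c) ?_
    (LinearEquiv.sumArrowLequivProdArrow _ _ ℤ ℤ).surjective
  intro y
  obtain ⟨v, hv⟩ := hb (g.rangeRestrict y)
  have h0 : g (y - c v) = 0 := by
    have := congrArg Subtype.val (LinearMap.congr_fun hc v)
    simp only [LinearMap.comp_apply, LinearMap.codRestrict_apply, hv] at this
    rw [map_sub, sub_eq_zero]
    exact this.symm
  obtain ⟨x, hx⟩ := (hfg _).1 h0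
  obtain ⟨u, rfl⟩ := ha x
  refine ⟨(u, v), ?_⟩
  change f (a u) = y - c v at hx
  simp [hx]

theorem IsGeneratedBy.injective_of_surjective {M : Type} [AddCommGroup M] {p : ℕ} {ι : Type}
    [Fintype ι] (hp : Fintype.card ι = p) (h : IsGeneratedBy M p) (g : M →ₗ[ℤ] (ι → ℤ))
    (hg : Function.Surjective g) : Function.Injective g := by
  obtain ⟨f, hf⟩ := h
  let e := LinearEquiv.funCongrLeft ℤ ℤ (Fintype.equivFinOfCardEq hp).symm
  have : Function.Injective (e.toLinearMap ∘ₗ g ∘ₗ f) :=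
    OrzechProperty.injective_of_surjective_endomorphism _
      (e.surjective.comp (hg.comp hf))
  intro x y hxy
  obtain ⟨u, rfl⟩ := hf x
  obtain ⟨v, rfl⟩ := hf y
  rw [this (a₁ := u) (a₂ := v) (by simp [hxy])]

section GroupCohomology

open CategoryTheory Rep

theorem Rep.exact_of_forall_exists {k G : Type} [CommRing k] [Group G]
    {S : ShortComplex (Rep.{0} k G)} (h : ∀ x, S.g.hom x = 0 → ∃ y, S.f.hom y = x) : S.Exact := by
  apply (forget₂ (Rep k G) (ModuleCat k)).reflects_exact_of_faithful
  rw [ShortComplex.moduleCat_exact_iff]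
  exact h

theorem Int.exists_forward_difference (h : ℤ → ℤ) : ∃ f : ℤ → ℤ, ∀ k, f (k + 1) - f k = h k := by
  let a : ℕ → ℤ := fun n ↦ ∑ i ∈ Finset.range n, h i
  let b : ℕ → ℤ := fun n ↦ -∑ i ∈ Finset.range n, h (-(i : ℤ) - 1)
  refine ⟨fun k ↦ if 0 ≤ k then a k.toNat else b (-k).toNat, fun k ↦ ?_⟩
  rcases lt_or_ge k 0 with hk | hk
  · obtain ⟨n, rfl⟩ : ∃ n : ℕ, k = -(n : ℤ) - 1 := ⟨(-k - 1).toNat, by omega⟩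
    have h1 : (-(-(n : ℤ) - 1)).toNat = n + 1 := by omega
    have h2 : ¬ (0 ≤ -(n : ℤ) - 1) := by omega
    simp only [h1, h2, if_false, sub_add_cancel, neg_neg, Int.toNat_natCast]
    rcases Nat.eq_zero_or_pos n with rfl | hn
    · simp [a, b]
    · simp [hn.ne', b, Finset.sum_range_succ]
  · lift k to ℕ using hk
    have h1 : ((k : ℤ) + 1).toNat = k + 1 := by omega
    have h2 : (0 : ℤ) ≤ (k : ℤ) + 1 := by omega
    simp [h1, h2, a, Finset.sum_range_succ]

variable {G : Type} [CommGroup G] (χ : G →* Multiplicative ℤ) (t : G)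

/-- The integral functions on `G` which are invariant under the kernel of `χ`. -/
noncomputable abbrev kerCoind : Rep ℤ G :=
  coind χ.ker.subtype (trivial ℤ χ.ker ℤ)

/-- The inclusion of the constant functions into `kerCoind χ`. -/
noncomputable def constToKerCoind : trivial ℤ G ℤ ⟶ kerCoind χ :=
  Rep.ofHom ⟨{ toFun := fun c ↦ ⟨fun _ ↦ c, fun _ _ ↦ rfl⟩
               map_add' := fun _ _ ↦ rfl
               map_smul' := fun _ _ ↦ rfl }, fun _ ↦ rfl⟩

/-- The complex `ℤ ⟶ kerCoind χ ⟶ kerCoind χ` whose second map is translation by `t` minus the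
identity. -/
noncomputable def kerCoindSequence : ShortComplex (Rep ℤ G) where
  X₁ := trivial ℤ G ℤ
  X₂ := kerCoind χ
  X₃ := kerCoind χ
  f := constToKerCoind χ
  g := applyAsHom (kerCoind χ) t - 𝟙 _
  zero := by
    rw [Preadditive.comp_sub, sub_eq_zero]
    rfl

variable {χ t}

theorem kerCoind_apply_eq (f : kerCoind χ) {a b : G} (h : χ a = χ b) : f.1 a = f.1 b := by
  have hm : a * b⁻¹ ∈ χ.ker := by simp [MonoidHom.mem_ker, h]
  have := f.2 ⟨_, hm⟩ b
  simpa using this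

theorem kerCoindSequence_shortExact (ht : χ t = Multiplicative.ofAdd 1) :
    (kerCoindSequence χ t).ShortExact where
  exact := by
    refine Rep.exact_of_forall_exists fun f hf ↦ ?_
    change kerCoind χ at f
    have hf' : ∀ g : G, f.1 (g * t) = f.1 g := by
      intro g
      have h0 : (kerCoind χ).ρ t f - f = 0 := hf
      exact congrFun (congrArg Subtype.val (sub_eq_zero.1 h0)) g
    have hz : ∀ (n : ℤ), f.1 (t ^ n) = f.1 1 := by
      intro n
      induction n using Int.induction_on with
      | zero => simp
      | succ k ih => rw [zpow_add_one, hf', ih]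
      | pred k ih => rw [← hf', ← zpow_add_one, sub_add_cancel, ih]
    refine ⟨(f.1 1 : ℤ), Subtype.ext (funext fun g ↦ ?_)⟩
    change f.1 1 = f.1 g
    rw [← hz (χ g).toAdd]
    apply kerCoind_apply_eq
    rw [map_zpow, ht, ← ofAdd_zsmul]
    simp
  mono_f := by
    rw [Rep.mono_iff_injective]
    intro x y hxy
    exact congrFun (congrArg Subtype.val hxy) (1 : G)
  epi_g := by
    rw [Rep.epi_iff_surjective]
    intro h
    change kerCoind χ at h
    obtain ⟨f, hf⟩ := Int.exists_forward_difference fun k ↦ h.1 (t ^ k)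
    refine ⟨⟨fun g ↦ f (χ g).toAdd, fun s g ↦ ?_⟩, Subtype.ext (funext fun g ↦ ?_)⟩
    · have : χ (s : G) = 1 := s.2
      change f (χ (s * g)).toAdd = f (χ g).toAdd
      simp [this]
    · change f (χ (g * t)).toAdd - f (χ g).toAdd = h.1 g
      rw [map_mul, ht, toAdd_mul, toAdd_ofAdd, hf]
      apply kerCoind_apply_eq
      rw [map_zpow, ht, ← ofAdd_zsmul]
      simp

theorem isGeneratedBy_groupCohomology_of_ker (ht : χ t = Multiplicative.ofAdd 1) {l p₁ p₃ : ℕ}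
    (h₁ : IsGeneratedBy (groupCohomology (trivial ℤ χ.ker ℤ) l) p₁)
    (h₃ : IsGeneratedBy (groupCohomology (trivial ℤ χ.ker ℤ) (l + 1)) p₃) :
    IsGeneratedBy (groupCohomology (trivial ℤ G ℤ) (l + 1)) (p₁ + p₃) := by
  have hX := kerCoindSequence_shortExact ht
  have hex := groupCohomology.mapShortComplex₁_exact hX (i := l) rfl
  have e (m : ℕ) : groupCohomology (trivial ℤ χ.ker ℤ) m ≃ₗ[ℤ] groupCohomology (kerCoind χ) m :=
    (groupCohomology.coindIso (trivial ℤ χ.ker ℤ) m).symm.toLinearEquiv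
  have h₁' := h₁.of_surjective (e l).toAddEquiv.toAddMonoidHom (e l).surjective
  have h₃' := h₃.of_surjective (e (l + 1)).toAddEquiv.toAddMonoidHom (e (l + 1)).surjective
  exact IsGeneratedBy.of_exact h₁' h₃' (groupCohomology.mapShortComplex₁ hX rfl).f.hom.toAddMonoidHom
    (groupCohomology.mapShortComplex₁ hX rfl).g.hom.toAddMonoidHom
    ((ShortComplex.ShortExact.moduleCat_exact_iff_function_exact _).1 hex)

theorem isGeneratedBy_groupCohomology_zero (G : Type) [Group G] :
    IsGeneratedBy (groupCohomology (trivial ℤ G ℤ) 0) 1 :=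
  (IsGeneratedBy.of_finite (ι := Unit) rfl (LinearEquiv.funUnique Unit ℤ ℤ).toLinearMap
    (LinearEquiv.funUnique Unit ℤ ℤ).surjective).of_surjective
    (groupCohomology.H0IsoOfIsTrivial (trivial ℤ G ℤ)).symm.toLinearEquiv.toAddEquiv.toAddMonoidHom
    (groupCohomology.H0IsoOfIsTrivial (trivial ℤ G ℤ)).symm.toLinearEquiv.surjective

theorem isGeneratedBy_groupCohomology_free (n : ℕ) :
    ∀ (G : Type) [CommGroup G], (G ≃* Multiplicative (Fin n → ℤ)) → ∀ l : ℕ,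
      IsGeneratedBy (groupCohomology (trivial ℤ G ℤ) l) (n.choose l) := by
  induction n with
  | zero =>
    intro G _ e l
    cases l with
    | zero => exact isGeneratedBy_groupCohomology_zero G
    | succ l =>
      have : Subsingleton G := e.injective.subsingleton
      have hz := isZero_groupCohomology_succ_of_subsingleton (trivial ℤ G ℤ) l
      have : Subsingleton (groupCohomology (trivial ℤ G ℤ) (l + 1)) :=
        ModuleCat.subsingleton_of_isZero hz
      exact ⟨0, fun y ↦ ⟨0, Subsingleton.elim _ _⟩⟩
  | succ n ih =>
    intro G _ e l
    cases l with
    | zero => simpa using isGeneratedBy_groupCohomology_zero G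
    | succ l =>
      let χ : G →* Multiplicative ℤ :=
        (AddMonoidHom.toMultiplicative (Pi.evalAddMonoidHom (fun _ : Fin (n + 1) ↦ ℤ) 0)).comp
          e.toMonoidHom
      have hχ (g : G) : (χ g).toAdd = (e g).toAdd 0 := rfl
      let t : G := e.symm (Multiplicative.ofAdd (Pi.single 0 1))
      have ht : χ t = Multiplicative.ofAdd 1 := by
        apply Multiplicative.toAdd.injective
        rw [hχ]
        simp [t]
      let e' : χ.ker ≃* Multiplicative (Fin n → ℤ) :=
        { toFun := fun g ↦ Multiplicative.ofAdd fun i ↦ (e g).toAdd i.succ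
          invFun := fun v ↦ ⟨e.symm (Multiplicative.ofAdd (Fin.cons 0 v.toAdd)), by
            rw [MonoidHom.mem_ker]
            apply Multiplicative.toAdd.injective
            rw [hχ]
            simp⟩
          left_inv := fun g ↦ by
            have hg : (e g).toAdd 0 = 0 := by
              rw [← hχ, MonoidHom.mem_ker.1 g.2]; rfl
            apply Subtype.ext
            change e.symm _ = (g : G)
            rw [MulEquiv.symm_apply_eq]
            apply Multiplicative.toAdd.injective
            funext i
            refine Fin.cases ?_ (fun i ↦ ?_) i
            · simp [hg]
            · simp
          right_inv := fun v ↦ by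
            apply Multiplicative.toAdd.injective
            funext i
            simp
          map_mul' := fun a b ↦ by
            apply Multiplicative.toAdd.injective
            funext i
            simp }
      rw [Nat.choose_succ_succ]
      exact isGeneratedBy_groupCohomology_of_ker ht (ih _ e' _) (ih _ e' _)

end GroupCohomology

section Antisymmetrization

open Equiv

/-- The antisymmetrization of a function of `l` variables. -/
def antisymmetrize {A : Type} {l : ℕ} (f : (Fin l → A) → ℤ) (w : Fin l → A) : ℤ :=
  ∑ σ : Perm (Fin l), (Perm.sign σ : ℤ) * f (w ∘ σ)

theorem antisymmetrize_add {A : Type} {l : ℕ} (f g : (Fin l → A) → ℤ) (w : Fin l → A) :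
    antisymmetrize (f + g) w = antisymmetrize f w + antisymmetrize g w := by
  simp [antisymmetrize, mul_add, Finset.sum_add_distrib]

theorem antisymmetrize_smul {A : Type} {l : ℕ} (c : ℤ) (f : (Fin l → A) → ℤ) (w : Fin l → A) :
    antisymmetrize (c • f) w = c * antisymmetrize f w := by
  simp only [antisymmetrize, Finset.mul_sum, Pi.smul_apply, smul_eq_mul]
  exact Finset.sum_congr rfl fun _ _ ↦ by ring

theorem antisymmetrize_comp_perm {A : Type} {l : ℕ} (f : (Fin l → A) → ℤ) (w : Fin l → A)
    (τ : Perm (Fin l)) : antisymmetrize f (w ∘ τ) = (Perm.sign τ : ℤ) * antisymmetrize f w := by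
  rw [antisymmetrize, antisymmetrize, Finset.mul_sum, ← Equiv.sum_comp (Equiv.mulLeft τ⁻¹)]
  refine Finset.sum_congr rfl fun σ _ ↦ ?_
  have h : (w ∘ τ) ∘ (τ⁻¹ * σ : Perm (Fin l)) = w ∘ σ := by
    funext i
    simp
  rw [coe_mulLeft, h]
  simp [mul_assoc]

theorem antisymmetrize_eq_zero_of_not_injective {A : Type} {l : ℕ} (f : (Fin l → A) → ℤ)
    {w : Fin l → A} (hw : ¬ Function.Injective w) : antisymmetrize f w = 0 := by
  simp only [Function.Injective, not_forall] at hw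
  obtain ⟨i, j, hij, hne⟩ := hw
  have h1 : w ∘ swap i j = w := by
    funext k
    simp only [Function.comp_apply, swap_apply_def]
    split_ifs with h h' <;> simp_all
  have h2 := antisymmetrize_comp_perm f w (swap i j)
  rw [h1, Perm.sign_swap hne] at h2
  push_cast at h2
  omega

theorem sum_sign_mul_eq_zero_of_swap {l : ℕ} {i j : Fin l} (hij : i ≠ j)
    (X : Perm (Fin l) → ℤ) (hX : ∀ σ, X (σ * swap i j) = X σ) :
    ∑ σ : Perm (Fin l), (Perm.sign σ : ℤ) * X σ = 0 := by
  have h : ∑ σ : Perm (Fin l), (Perm.sign σ : ℤ) * X σ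
      = -∑ σ : Perm (Fin l), (Perm.sign σ : ℤ) * X σ := by
    conv_lhs => rw [← Equiv.sum_comp (Equiv.mulRight (swap i j))]
    rw [← Finset.sum_neg_distrib]
    refine Finset.sum_congr rfl fun σ _ ↦ ?_
    simp [hX, Perm.sign_swap hij]
  omega

theorem antisymmetrize_barDiff {A : Type} [AddCommGroup A] (l : ℕ) (f : (Fin l → A) → ℤ)
    (w : Fin (l + 1) → A) : antisymmetrize (barDiff A l f) w = 0 := by
  have hends : ∑ σ : Perm (Fin (l + 1)), (Perm.sign σ : ℤ) * f (fun i ↦ w (σ i.succ))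
      = (-1) ^ l *
        ∑ σ : Perm (Fin (l + 1)), (Perm.sign σ : ℤ) * f (fun i ↦ w (σ i.castSucc)) := by
    rw [Finset.mul_sum, ← Equiv.sum_comp (Equiv.mulRight (finRotate (l + 1))) (fun σ ↦
      (-1) ^ l * ((Perm.sign σ : ℤ) * f (fun i ↦ w (σ i.castSucc))))]
    refine Finset.sum_congr rfl fun σ _ ↦ ?_
    have h1 : ((-1 : ℤ) ^ l) * (-1) ^ l = 1 := by rw [← mul_pow]; simp
    simp only [coe_mulRight, Perm.sign_mul, sign_finRotate, Perm.mul_apply, finRotate_apply, add_tsub_cancel_right,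
      Fin.coeSucc_eq_succ, Units.val_mul, Units.val_pow_eq_pow_val, Units.val_neg, Units.val_one]
    linear_combination (-(Perm.sign σ : ℤ) * f (fun i ↦ w (σ i.succ))) * h1
  have hmid (i : ℕ) (hi : i ∈ Finset.range l) :
      ∑ σ : Perm (Fin (l + 1)), (Perm.sign σ : ℤ) *
        f (fun j ↦ if (j : ℕ) < i then w (σ j.castSucc)
            else if (j : ℕ) = i then w (σ j.castSucc) + w (σ j.succ)
            else w (σ j.succ)) = 0 := by
    rw [Finset.mem_range] at hi
    apply sum_sign_mul_eq_zero_of_swap (i := (⟨i, by omega⟩ : Fin (l + 1)))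
      (j := ⟨i + 1, by omega⟩) (by simp [Fin.ext_iff])
    intro σ
    congr 1
    funext j
    rcases lt_trichotomy (j : ℕ) i with h | h | h
    · simp only [h, if_true, Perm.mul_apply]
      rw [swap_apply_of_ne_of_ne] <;> simp [Fin.ext_iff] <;> omega
    · have h1 : j.castSucc = (⟨i, by omega⟩ : Fin (l + 1)) := by simp [Fin.ext_iff, h]
      have h2 : j.succ = (⟨i + 1, by omega⟩ : Fin (l + 1)) := by simp [Fin.ext_iff, h]
      simp only [h, lt_irrefl, if_false, if_true, Perm.mul_apply, h1, h2, swap_apply_left,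
        swap_apply_right]
      exact add_comm _ _
    · have h1 : ¬ (j : ℕ) < i := by omega
      have h2 : ¬ (j : ℕ) = i := by omega
      simp only [h1, h2, if_false, Perm.mul_apply]
      rw [swap_apply_of_ne_of_ne] <;> simp [Fin.ext_iff] <;> omega
  have hsum : antisymmetrize (barDiff A l f) w =
      ∑ σ : Perm (Fin (l + 1)), (Perm.sign σ : ℤ) * f (fun i ↦ w (σ i.succ))
      + ∑ i ∈ Finset.range l, (-1 : ℤ) ^ (i + 1) * ∑ σ : Perm (Fin (l + 1)), (Perm.sign σ : ℤ) *
        f (fun j ↦ if (j : ℕ) < i then w (σ j.castSucc)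
            else if (j : ℕ) = i then w (σ j.castSucc) + w (σ j.succ)
            else w (σ j.succ))
      + (-1) ^ (l + 1) *
        ∑ σ : Perm (Fin (l + 1)), (Perm.sign σ : ℤ) * f (fun i ↦ w (σ i.castSucc)) := by
    simp only [antisymmetrize, barDiff, Function.comp_apply, mul_add, Finset.sum_add_distrib,
      Finset.mul_sum]
    rw [Finset.sum_comm]
    congr 1
    · congr 1
      exact Finset.sum_congr rfl fun _ _ ↦ Finset.sum_congr rfl fun _ _ ↦ by ring
    · exact Finset.sum_congr rfl fun _ _ ↦ by ring
  rw [hsum, hends, Finset.sum_eq_zero (s := Finset.range l) fun i hi ↦ by rw [hmid i hi, mul_zero]]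
  ring

theorem sum_perm_eq_zero_of_forall_sum {G : Type} [Group G] [Fintype G] {K : Type} [Fintype K]
    [Nonempty K] (e : K → G) (X : G → ℤ) (h : ∀ σ, ∑ τ, X (σ * e τ) = 0) : ∑ σ, X σ = 0 := by
  have h1 : ∑ τ : K, ∑ σ, X σ = 0 := by
    rw [Finset.sum_congr rfl fun τ _ ↦ (Equiv.sum_comp (Equiv.mulRight (e τ)) X).symm, Finset.sum_comm]
    exact Finset.sum_eq_zero fun σ _ ↦ h σ
  simpa using h1

theorem antisymmetrize_barCup_of_left {A ι : Type} (b : ι → A) {p q : ℕ} {f : (Fin p → A) → ℤ}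
    (g : (Fin q → A) → ℤ) (hf : ∀ v : Fin p → ι, antisymmetrize f (b ∘ v) = 0)
    (v : Fin (p + q) → ι) : antisymmetrize (barCup A p q f g) (b ∘ v) = 0 := by
  refine sum_perm_eq_zero_of_forall_sum (K := Perm (Fin p))
    (fun τ ↦ finSumFinEquiv.permCongr (Perm.sumCongr τ 1)) _ fun σ ↦ ?_
  have := hf (fun i ↦ v (σ (Fin.castAdd q i)))
  rw [antisymmetrize] at this
  rw [← mul_zero ((Perm.sign σ : ℤ) * g (fun j ↦ b (v (σ (Fin.natAdd p j))))), ← this,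
    Finset.mul_sum]
  refine Finset.sum_congr rfl fun τ _ ↦ ?_
  simp only [barCup, Perm.sign_mul, Perm.sign_permCongr, Perm.sign_sumCongr, Perm.sign_one,
    Function.comp_apply, Perm.mul_apply, permCongr_apply, finSumFinEquiv_symm_apply_castAdd,
    finSumFinEquiv_symm_apply_natAdd, Perm.sumCongr_apply, Sum.map_inl, Sum.map_inr, mul_one,
    finSumFinEquiv_apply_left, finSumFinEquiv_apply_right, Perm.one_apply, Units.val_mul]
  change _ * (f ((b ∘ fun i ↦ v (σ (Fin.castAdd q i))) ∘ τ) * _) = _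
  ring

theorem antisymmetrize_barCup_of_right {A ι : Type} (b : ι → A) {p q : ℕ} (f : (Fin p → A) → ℤ)
    {g : (Fin q → A) → ℤ} (hg : ∀ v : Fin q → ι, antisymmetrize g (b ∘ v) = 0)
    (v : Fin (p + q) → ι) : antisymmetrize (barCup A p q f g) (b ∘ v) = 0 := by
  refine sum_perm_eq_zero_of_forall_sum (K := Perm (Fin q))
    (fun τ ↦ finSumFinEquiv.permCongr (Perm.sumCongr 1 τ)) _ fun σ ↦ ?_
  have := hg (fun i ↦ v (σ (Fin.natAdd p i)))
  rw [antisymmetrize] at this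
  rw [← mul_zero ((Perm.sign σ : ℤ) * f (fun j ↦ b (v (σ (Fin.castAdd q j))))), ← this,
    Finset.mul_sum]
  refine Finset.sum_congr rfl fun τ _ ↦ ?_
  simp only [barCup, Perm.sign_mul, Perm.sign_permCongr, Perm.sign_sumCongr, Perm.sign_one,
    Function.comp_apply, Perm.mul_apply, permCongr_apply, finSumFinEquiv_symm_apply_castAdd,
    finSumFinEquiv_symm_apply_natAdd, Perm.sumCongr_apply, Sum.map_inl, Sum.map_inr, one_mul,
    finSumFinEquiv_apply_left, finSumFinEquiv_apply_right, Perm.one_apply, Units.val_mul]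
  change _ * (_ * g ((b ∘ fun i ↦ v (σ (Fin.natAdd p i))) ∘ τ)) = _
  ring

theorem barDiff_prod {A : Type} [AddCommGroup A] (l : ℕ) (χ : Fin l → A →+ ℤ) :
    barDiff A l (fun a ↦ ∏ k, χ k (a k)) = 0 := by
  funext a
  let P : ℕ → ℤ := fun m ↦ ∏ k : Fin l, χ k (if (k : ℕ) < m then a k.castSucc else a k.succ)
  have hmid (i : ℕ) (hi : i ∈ Finset.range l) :
      (∏ k : Fin l, χ k (if (k : ℕ) < i then a k.castSucc
            else if (k : ℕ) = i then a k.castSucc + a k.succ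
            else a k.succ)) = P (i + 1) + P i := by
    rw [Finset.mem_range] at hi
    have hm := Finset.mem_univ (⟨i, hi⟩ : Fin l)
    simp only [P]
    rw [← Finset.mul_prod_erase _ _ hm, ← Finset.mul_prod_erase _ _ hm,
      ← Finset.mul_prod_erase _ _ hm]
    have h1 : ∀ k ∈ Finset.univ.erase (⟨i, hi⟩ : Fin l), (k : ℕ) ≠ i := fun k hk h ↦
      Finset.ne_of_mem_erase hk (Fin.ext h)
    rw [Finset.prod_congr (g := fun k ↦ χ k (if (k : ℕ) < i then a k.castSucc else a k.succ)) rfl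
        fun k hk ↦ by simp [h1 k hk],
      Finset.prod_congr (f := fun k ↦ χ k (if (k : ℕ) < i + 1 then a k.castSucc else a k.succ))
        (g := fun k ↦ χ k (if (k : ℕ) < i then a k.castSucc else a k.succ)) rfl fun k hk ↦ by
          have h2 : (k : ℕ) < i + 1 ↔ (k : ℕ) < i := by have := h1 k hk; omega
          simp only [h2]]
    simp only [lt_irrefl, if_false, if_true, Nat.lt_succ_self, map_add]
    ring
  have h0 : ∏ k, χ k (a k.succ) = P 0 := by simp [P]
  have hl : ∏ k, χ k (a k.castSucc) = P l := by simp [P]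
  simp only [barDiff, Pi.zero_apply]
  rw [h0, hl, Finset.sum_congr rfl fun i hi ↦ show _ = (-1) ^ (i + 1) * P (i + 1) - (-1) ^ i * P i
    by rw [hmid i hi]; ring, Finset.sum_range_sub (fun i ↦ (-1) ^ i * P i)]
  ring

end Antisymmetrization

section Cocycles

open CategoryTheory Module

theorem antisymmetrize_prod_coord {A : Type} [AddCommGroup A] {n l : ℕ} (b : Basis (Fin n) ℤ A)
    (S T : {s : Finset (Fin n) // s.card = l}) :
    antisymmetrize (fun a ↦ ∏ k, (b.coord (T.1.orderEmbOfFin T.2 k)).toAddMonoidHom (a k))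
      (b ∘ S.1.orderEmbOfFin S.2) = if S = T then 1 else 0 := by
  have h (σ : Equiv.Perm (Fin l)) :
      ∏ k, (b.coord (T.1.orderEmbOfFin T.2 k)).toAddMonoidHom
          (((b ∘ S.1.orderEmbOfFin S.2) ∘ σ) k)
        = if S = T ∧ σ = 1 then 1 else 0 := by
    split_ifs with hST
    · obtain ⟨rfl, rfl⟩ := hST
      simp
    · rw [Finset.prod_eq_zero_iff]
      by_contra! hne
      have hk (k : Fin l) : S.1.orderEmbOfFin S.2 (σ k) = T.1.orderEmbOfFin T.2 k := by
        have := hne k (Finset.mem_univ k)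
        simpa [Finsupp.single_apply] using this
      have hr : S = T := by
        apply Subtype.ext
        rw [← Finset.coe_inj, ← Finset.range_orderEmbOfFin S.1 S.2,
          ← Finset.range_orderEmbOfFin T.1 T.2, ← σ.surjective.range_comp]
        exact congrArg Set.range (funext hk)
      subst hr
      exact hST ⟨rfl, Equiv.ext fun k ↦ (S.1.orderEmbOfFin S.2).injective (hk k)⟩
  simp only [antisymmetrize, h]
  by_cases hST : S = T <;> simp [hST]

theorem antisymmetrize_eq_zero_of_orderEmbOfFin {A : Type} {n l : ℕ} (b : Fin n → A)
    {f : (Fin l → A) → ℤ}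
    (hf : ∀ S : {s : Finset (Fin n) // s.card = l},
      antisymmetrize f (b ∘ S.1.orderEmbOfFin S.2) = 0)
    (v : Fin l → Fin n) : antisymmetrize f (b ∘ v) = 0 := by
  by_cases hv : Function.Injective v
  · let S : {s : Finset (Fin n) // s.card = l} :=
      ⟨Finset.univ.image v, by simp [Finset.card_image_of_injective _ hv]⟩
    let τ : Fin l → Fin l := fun i ↦ (S.1.orderIsoOfFin S.2).symm ⟨v i, by simp [S]⟩
    have hτ (i : Fin l) : S.1.orderEmbOfFin S.2 (τ i) = v i := by
      simp [τ, ← Finset.coe_orderIsoOfFin_apply]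
    have hτi : Function.Injective τ := fun i j h ↦ hv (by rw [← hτ, ← hτ, h])
    let τ' : Equiv.Perm (Fin l) := Equiv.ofBijective τ (Finite.injective_iff_bijective.1 hτi)
    have h : b ∘ v = (b ∘ S.1.orderEmbOfFin S.2) ∘ τ' := funext fun i ↦ congrArg b (hτ i).symm
    rw [h, antisymmetrize_comp_perm, hf, mul_zero]
  · exact antisymmetrize_eq_zero_of_not_injective f
      fun h ↦ hv (Function.Injective.of_comp h)

/-- The values of the antisymmetrization of a cochain on increasing families of vectors of a
basis. -/
def altCoords {A : Type} {n : ℕ} (b : Fin n → A) (l : ℕ) :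
    ((Fin l → A) → ℤ) →ₗ[ℤ] ({s : Finset (Fin n) // s.card = l} → ℤ) where
  toFun f S := antisymmetrize f (b ∘ S.1.orderEmbOfFin S.2)
  map_add' f g := funext fun _ ↦ antisymmetrize_add f g _
  map_smul' c f := funext fun _ ↦ antisymmetrize_smul c f _

/-- The differential of the bar cochain complex as a linear map. -/
def barDiffLinear (A : Type) [AddCommGroup A] (l : ℕ) :
    ((Fin l → A) → ℤ) →ₗ[ℤ] ((Fin (l + 1) → A) → ℤ) where
  toFun := barDiff A l
  map_add' f g := by
    funext a
    simp only [barDiff, Pi.add_apply, mul_add, Finset.sum_add_distrib]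
    ring
  map_smul' c f := by
    funext a
    simp only [barDiff, Pi.smul_apply, smul_eq_mul, RingHom.id_apply, mul_add, Finset.mul_sum,
      mul_left_comm c]

theorem exists_cocycle_altCoords_eq {A : Type} [AddCommGroup A] {n : ℕ} (b : Basis (Fin n) ℤ A)
    (l : ℕ) (w : {s : Finset (Fin n) // s.card = l} → ℤ) :
    ∃ z, barDiff A l z = 0 ∧ altCoords b l z = w := by
  refine ⟨∑ T, w T • fun a ↦ ∏ k, (b.coord (T.1.orderEmbOfFin T.2 k)).toAddMonoidHom (a k),
    ?_, ?_⟩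
  · change barDiffLinear A l _ = 0
    simp only [map_sum, map_smul]
    refine Finset.sum_eq_zero fun T _ ↦ ?_
    have : barDiffLinear A l (fun a ↦ ∏ k,
        (b.coord (T.1.orderEmbOfFin T.2 k)).toAddMonoidHom (a k)) = 0 := barDiff_prod l _
    rw [this, smul_zero]
  · simp only [map_sum, map_smul]
    funext S
    simp only [Finset.sum_apply, Pi.smul_apply]
    have (T : {s : Finset (Fin n) // s.card = l}) : altCoords b l (fun a ↦ ∏ k,
        (b.coord (T.1.orderEmbOfFin T.2 k)).toAddMonoidHom (a k)) S = if S = T then 1 else 0 :=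
      antisymmetrize_prod_coord b S T
    simp only [this, smul_eq_mul, mul_ite, mul_one, mul_zero, Finset.sum_ite_eq,
      Finset.mem_univ, if_true]

theorem inhomogeneousCochains_d_eq_barDiff (A : Type) [AddCommGroup A] (l : ℕ)
    (f : (Fin l → A) → ℤ) :
    inhomogeneousCochains.d (Rep.trivial ℤ (Multiplicative A) ℤ) l f = barDiff A l f := by
  funext a
  change (Fin (l + 1) → A) at a
  change f (fun i ↦ a i.succ) + ∑ j : Fin (l + 1),
    (-1 : ℤ) ^ ((j : ℕ) + 1) • f (Fin.contractNth j (· + ·) a) = _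
  rw [Fin.sum_univ_castSucc, ← add_assoc]
  simp only [barDiff, Finset.sum_range]
  congr 3
  funext j
  simp [Fin.contractNth]

theorem HomologicalComplex.exists_d_eq_of_homologyπ_eq_zero {k : Type} [Ring k]
    (K : CochainComplex (ModuleCat.{0} k) ℕ) (i : ℕ) (z : K.cycles (i + 1))
    (hz : K.homologyπ (i + 1) z = 0) : ∃ y, K.d i (i + 1) y = K.iCycles (i + 1) z := by
  have hex : (ShortComplex.mk (K.toCycles i (i + 1)) (K.homologyπ (i + 1)) (by simp)).Exact :=
    ShortComplex.exact_of_g_is_cokernel _ (K.homologyIsCokernel i (i + 1) (by simp))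
  obtain ⟨y, hy⟩ := (ShortComplex.moduleCat_exact_iff _).1 hex z hz
  refine ⟨y, ?_⟩
  rw [← hy]
  change _ = (K.toCycles i (i + 1) ≫ K.iCycles (i + 1)) y
  rw [HomologicalComplex.toCycles_i]

theorem exists_addMonoidHom_lift {M N : Type} [AddCommGroup M] [AddCommGroup N] {p : ℕ}
    (f : (Fin p → ℤ) →ₗ[ℤ] N) (P : M →+ N) (hP : Function.Surjective P) :
    ∃ g : (Fin p → ℤ) →+ M, ∀ u, P (g u) = f u := by
  obtain ⟨g, hg⟩ := Module.projective_lifting_property P.toIntLinearMap f hP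
  exact ⟨g.toAddMonoidHom, fun u ↦ LinearMap.congr_fun hg u⟩

theorem exists_cocycle_family (A : Type) [AddCommGroup A] (l : ℕ) {p : ℕ}
    (h : IsGeneratedBy (groupCohomology (Rep.trivial ℤ (Multiplicative A) ℤ) (l + 1)) p) :
    ∃ g : (Fin p → ℤ) →ₗ[ℤ] ((Fin (l + 1) → A) → ℤ), (∀ u, barDiff A (l + 1) (g u) = 0) ∧
      ∀ z, barDiff A (l + 1) z = 0 → ∃ u y, z = g u + barDiff A l y := by
  obtain ⟨f, hf⟩ := h
  let K := groupCohomology.inhomogeneousCochains (Rep.trivial ℤ (Multiplicative A) ℤ)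
  have hK (m : ℕ) (x : (Fin m → A) → ℤ) : K.d m (m + 1) x = barDiff A m x := by
    rw [← inhomogeneousCochains_d_eq_barDiff]
    change (groupCohomology.inhomogeneousCochains _).d m (m + 1) _ = _
    rw [groupCohomology.inhomogeneousCochains.d_def]
  let P : K.cycles (l + 1) →+ groupCohomology (Rep.trivial ℤ (Multiplicative A) ℤ) (l + 1) :=
    (K.homologyπ (l + 1)).hom.toAddMonoidHom
  have hP : Function.Surjective P :=
    (ModuleCat.epi_iff_surjective (K.homologyπ (l + 1))).1 inferInstance
  obtain ⟨g, hg⟩ := exists_addMonoidHom_lift f P hP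
  let ι : K.cycles (l + 1) →+ ((Fin (l + 1) → A) → ℤ) :=
    (K.iCycles (l + 1)).hom.toAddMonoidHom
  refine ⟨(ι.comp g).toIntLinearMap, fun u ↦ ?_, fun z hz ↦ ?_⟩
  · rw [← hK]
    change (K.iCycles (l + 1) ≫ K.d (l + 1) (l + 1 + 1)) (g u) = 0
    simp
  · let zc : K.cycles (l + 1) := K.cyclesMk z (l + 1 + 1) (by simp) ((hK _ z).trans hz)
    have hzc : ι zc = z := K.i_cyclesMk z (l + 1 + 1) (by simp) ((hK _ z).trans hz)
    obtain ⟨u, hu⟩ := hf (P zc)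
    have h0 : P (zc - g u) = 0 := by
      rw [map_sub, ← hu, sub_eq_zero]
      exact (hg u).symm
    obtain ⟨y, hy⟩ := HomologicalComplex.exists_d_eq_of_homologyπ_eq_zero K l (zc - g u) h0
    refine ⟨u, y, ?_⟩
    have h1 : barDiff A l y = ι (zc - g u) := (hK l y).symm.trans hy
    rw [h1, map_sub, hzc]
    simp

theorem exists_barDiff_eq_of_altCoords_eq_zero {A : Type} [AddCommGroup A] {n : ℕ}
    (b : Basis (Fin n) ℤ A) (l : ℕ) {z : (Fin (l + 1) → A) → ℤ}
    (hz : barDiff A (l + 1) z = 0) (h0 : altCoords b (l + 1) z = 0) : ∃ y, barDiff A l y = z := by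
  have hgen := isGeneratedBy_groupCohomology_free n (Multiplicative A)
    (AddEquiv.toMultiplicative b.equivFun.toAddEquiv) (l + 1)
  obtain ⟨g, hg0, hg⟩ := exists_cocycle_family A l hgen
  have hd (y : (Fin l → A) → ℤ) : altCoords b (l + 1) (barDiff A l y) = 0 :=
    funext fun S ↦ antisymmetrize_barDiff l y _
  have hsurj : Function.Surjective (altCoords b (l + 1) ∘ₗ g) := by
    intro w
    obtain ⟨z, hz, hw⟩ := exists_cocycle_altCoords_eq b (l + 1) w
    obtain ⟨u, y, rfl⟩ := hg z hz
    rw [map_add, hd, add_zero] at hw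
    exact ⟨u, hw⟩
  have hinj := IsGeneratedBy.injective_of_surjective (by simp)
    (⟨LinearMap.id, Function.surjective_id⟩ : IsGeneratedBy (Fin (n.choose (l + 1)) → ℤ) _)
    _ hsurj
  obtain ⟨u, y, rfl⟩ := hg z hz
  rw [map_add, hd, add_zero] at h0
  have hu : u = 0 := hinj (by rw [map_zero]; exact h0)
  exact ⟨y, by simp [hu]⟩

end Cocycles

section Graded

theorem map_mul_of_right_eq_zero {C : Type} [Ring C] (𝒜 : ℕ → Submodule ℤ C) [GradedAlgebra 𝒜]
    (d : C →ₗ[ℤ] C)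
    (hleib : ∀ (i : ℕ), ∀ x ∈ 𝒜 i, ∀ y : C,
      d (x * y) = d x * y + ((-1 : ℤ) ^ i) • (x * d y))
    (x : C) {y : C} (hy : d y = 0) : d (x * y) = d x * y := by
  induction x using DirectSum.Decomposition.inductionOn 𝒜 with
  | zero => simp
  | @homogeneous i x => rw [hleib i x x.2, hy, mul_zero, smul_zero, add_zero]
  | add x x' hx hx' => rw [add_mul, map_add, hx, hx', map_add, add_mul]

theorem decompose_map_succ {C : Type} [Ring C] (𝒜 : ℕ → Submodule ℤ C) [GradedAlgebra 𝒜]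
    (d : C →ₗ[ℤ] C) (hddeg : ∀ (i : ℕ), ∀ x ∈ 𝒜 i, d x ∈ 𝒜 (i + 1)) (x : C) (l : ℕ) :
    (DirectSum.decompose 𝒜 (d x) (l + 1) : C) = d (DirectSum.decompose 𝒜 x l) := by
  induction x using DirectSum.Decomposition.inductionOn 𝒜 with
  | zero => simp
  | @homogeneous i x =>
    by_cases h : i = l
    · subst h
      rw [DirectSum.decompose_of_mem_same 𝒜 (hddeg i x x.2), DirectSum.decompose_of_mem_same 𝒜 x.2]
    · rw [DirectSum.decompose_of_mem_ne 𝒜 (hddeg i x x.2) (by omega),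
        DirectSum.decompose_of_mem_ne 𝒜 x.2 h, map_zero]
  | add x x' hx hx' => simp [hx, hx']

theorem map_eq_zero_of_mem_zero {C : Type} [Ring C] (𝒜 : ℕ → Submodule ℤ C) [GradedAlgebra 𝒜]
    (d : C →ₗ[ℤ] C) (hddeg : ∀ (i : ℕ), ∀ x ∈ 𝒜 i, d x ∈ 𝒜 (i + 1)) {x : C}
    (hx : d x ∈ 𝒜 0) : d x = 0 := by
  rw [← DirectSum.decompose_of_mem_same 𝒜 hx]
  clear hx
  induction x using DirectSum.Decomposition.inductionOn 𝒜 with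
  | zero => simp
  | @homogeneous i x =>
    exact DirectSum.decompose_of_mem_ne 𝒜 (hddeg i x x.2) (by omega)
  | add x x' hx hx' => simp [hx, hx']

/-- Projecting cochains to cohomology along a complement of the cocycles. -/
theorem exists_retraction {C H : Type} [Ring C] [Ring H] (d : C →ₗ[ℤ] C) (π : C → H)
    (hπadd : ∀ x y : C, d x = 0 → d y = 0 → π (x + y) = π x + π y)
    (hπker : ∀ x : C, d x = 0 → (π x = 0 ↔ ∃ y : C, d y = x))
    (N : AddSubgroup C) (hNex : ∀ x ∈ N, d x = 0 → ∃ y, d y = x)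
    (hNz : ∀ x, ∃ z, d z = 0 ∧ x - z ∈ N) :
    ∃ G : C →+ H, (∀ z, d z = 0 → G z = π z) ∧ ∀ x ∈ N, G x = 0 := by
  choose r hr0 hrN using hNz
  have hG (x z : C) (hz : d z = 0) (hxz : x - z ∈ N) : π (r x) = π z := by
    have h1 : r x - z ∈ N := by
      have := N.sub_mem hxz (hrN x)
      rwa [sub_sub_sub_cancel_left] at this
    have h2 : d (r x - z) = 0 := by rw [map_sub, hr0, hz, sub_zero]
    have h3 := hπadd (r x - z) z h2 hz
    rwa [sub_add_cancel, (hπker _ h2).2 (hNex _ h1 h2), zero_add] at h3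
  refine ⟨AddMonoidHom.mk' (fun x ↦ π (r x)) fun x y ↦ ?_, fun z hz ↦ ?_, fun x hx ↦ ?_⟩
  · rw [← hπadd _ _ (hr0 x) (hr0 y)]
    apply hG _ _ (by rw [map_add, hr0, hr0, add_zero])
    rw [add_sub_add_comm]
    exact N.add_mem (hrN x) (hrN y)
  · exact hG z z hz (by simp)
  · change π (r x) = 0
    rw [hG x 0 (map_zero d) (by simpa using hx)]
    exact (hπker 0 (map_zero d)).2 ⟨0, map_zero d⟩

/-- If the cocycles admit a complement modulo coboundaries which is a homogeneous ideal, then the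
canonical Hochschild cocycle of the cohomology ring is a coboundary. -/
theorem exists_coboundary_of_ideal {C : Type} [Ring C]
    (𝒜 : ℕ → Submodule ℤ C) [GradedAlgebra 𝒜]
    (d : C →ₗ[ℤ] C)
    (hddeg : ∀ (i : ℕ), ∀ x ∈ 𝒜 i, d x ∈ 𝒜 (i + 1))
    (hleib : ∀ (i : ℕ), ∀ x ∈ 𝒜 i, ∀ y : C,
      d (x * y) = d x * y + ((-1 : ℤ) ^ i) • (x * d y))
    {H : Type} [Ring H]
    (ℋ : ℕ → Submodule ℤ H) [GradedAlgebra ℋ]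
    (π : C → H)
    (hπadd : ∀ x y : C, d x = 0 → d y = 0 → π (x + y) = π x + π y)
    (hπmul : ∀ x y : C, d x = 0 → d y = 0 → π (x * y) = π x * π y)
    (hπdeg : ∀ (i : ℕ), ∀ x ∈ 𝒜 i, d x = 0 → π x ∈ ℋ i)
    (hπker : ∀ x : C, d x = 0 → (π x = 0 ↔ ∃ y : C, d y = x))
    (s : H →ₗ[ℤ] C)
    (hs0 : ∀ h : H, d (s h) = 0)
    (hsπ : ∀ h : H, π (s h) = h)
    (hsdeg : ∀ (i : ℕ), ∀ h ∈ ℋ i, s h ∈ 𝒜 i)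
    (q : C → C)
    (hqd : ∀ x : C, (∃ y, d y = x) → d (q x) = x)
    (hqadd : ∀ x y : C, (∃ u, d u = x) → (∃ v, d v = y) → q (x + y) = q x + q y)
    (hqsmul : ∀ (a : ℤ) (x : C), (∃ y, d y = x) → q (a • x) = a • q x)
    (hqdeg : ∀ (i : ℕ), ∀ x : C, (∃ y, d y = x) → x ∈ 𝒜 (i + 1) → q x ∈ 𝒜 i)
    (N : AddSubgroup C) (hNex : ∀ x ∈ N, d x = 0 → ∃ y, d y = x)
    (hNz : ∀ m, ∀ x ∈ 𝒜 m, ∃ z ∈ 𝒜 m, d z = 0 ∧ x - z ∈ N)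
    (hNl : ∀ x, ∀ y ∈ N, x * y ∈ N) (hNr : ∀ x ∈ N, ∀ y, x * y ∈ N) :
    ∃ a : H →ₗ[ℤ] H →ₗ[ℤ] H,
      (∀ (i j : ℕ), ∀ x ∈ ℋ i, ∀ y ∈ ℋ j, a x y ∈ ℋ (i + j - 1)) ∧
      ∀ (i j l : ℕ) (x y z : H), x ∈ ℋ i → y ∈ ℋ j → z ∈ ℋ l →
        π (Theta s q i x y z)
          = ((-1 : ℤ) ^ i) • (x * a y z) - a (x * y) z + a x (y * z) - a x y * z := by
  have hNz' (x : C) : ∃ z, d z = 0 ∧ x - z ∈ N := by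
    induction x using DirectSum.Decomposition.inductionOn 𝒜 with
    | zero => exact ⟨0, map_zero d, by simp⟩
    | @homogeneous i x =>
      obtain ⟨z, -, hz⟩ := hNz i x x.2
      exact ⟨z, hz⟩
    | add x x' hx hx' =>
      obtain ⟨z, hz, hzN⟩ := hx
      obtain ⟨z', hz', hzN'⟩ := hx'
      refine ⟨z + z', by rw [map_add, hz, hz', add_zero], ?_⟩
      rw [add_sub_add_comm]
      exact N.add_mem hzN hzN'
  obtain ⟨G, hGπ, hGN⟩ := exists_retraction d π hπadd hπker N hNex hNz'
  have hdmul (x : C) {y : C} (hy : d y = 0) : d (x * y) = d x * y :=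
    map_mul_of_right_eq_zero 𝒜 d hleib x hy
  have hGeq {x z : C} (hz : d z = 0) (h : x - z ∈ N) : G x = π z := by
    rw [← hGπ z hz, ← sub_eq_zero, ← map_sub, hGN _ h]
  have hGl (h : H) (c : C) : G (s h * c) = h * G c := by
    obtain ⟨z, hz, hzN⟩ := hNz' c
    rw [hGeq hz hzN, hGeq (z := s h * z) (by rw [hdmul _ hz, hs0, zero_mul])
      (by rw [← mul_sub]; exact hNl _ _ hzN), hπmul _ _ (hs0 h) hz, hsπ]
  have hGr (h : H) (c : C) : G (c * s h) = G c * h := by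
    obtain ⟨z, hz, hzN⟩ := hNz' c
    rw [hGeq hz hzN, hGeq (z := z * s h) (by rw [hdmul _ (hs0 h), hz, zero_mul])
      (by rw [← sub_mul]; exact hNr _ hzN _), hπmul _ _ hz (hs0 h), hsπ]
  have hGdeg (m : ℕ) (c : C) (hc : c ∈ 𝒜 m) : G c ∈ ℋ m := by
    obtain ⟨z, hzm, hz, hzN⟩ := hNz m c hc
    rw [hGeq hz hzN]
    exact hπdeg m z hzm hz
  have hcob (x y : H) : ∃ u, d u = s x * s y - s (x * y) := by
    have h1 : d (s x * s y) = 0 := by rw [hdmul _ (hs0 y), hs0, zero_mul]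
    have h2 : d (s x * s y - s (x * y)) = 0 := by rw [map_sub, h1, hs0, sub_zero]
    refine (hπker _ h2).1 ?_
    rw [← hGπ _ h2, map_sub, hGπ _ h1, hGπ _ (hs0 _), hπmul _ _ (hs0 x) (hs0 y), hsπ, hsπ, hsπ,
      sub_self]
  have hdQ (x y : H) : d (Qmap s q x y) = s x * s y - s (x * y) := hqd _ (hcob x y)
  let a : H →ₗ[ℤ] H →ₗ[ℤ] H := LinearMap.mk₂ ℤ (fun x y ↦ G (Qmap s q x y))
    (fun x x' y ↦ by
      rw [← map_add, Qmap, Qmap, Qmap, ← hqadd _ _ (hcob x y) (hcob x' y), map_add, add_mul,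
        add_mul, map_add, add_sub_add_comm])
    (fun c x y ↦ by
      rw [← map_zsmul, Qmap, Qmap, ← hqsmul _ _ (hcob x y), map_smul, smul_mul_assoc,
        smul_mul_assoc, map_smul, smul_sub])
    (fun x y y' ↦ by
      rw [← map_add, Qmap, Qmap, Qmap, ← hqadd _ _ (hcob x y) (hcob x y'), map_add, mul_add,
        mul_add, map_add, add_sub_add_comm])
    (fun c x y ↦ by
      rw [← map_zsmul, Qmap, Qmap, ← hqsmul _ _ (hcob x y), map_smul, mul_smul_comm,
        mul_smul_comm, map_smul, smul_sub])
  have ha (x y : H) : a x y = G (Qmap s q x y) := rfl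
  refine ⟨a, fun i j x hx y hy ↦ ?_, fun i j l x y z hx hy hz ↦ ?_⟩
  · have hmem : s x * s y - s (x * y) ∈ 𝒜 (i + j) :=
      (𝒜 (i + j)).sub_mem (SetLike.mul_mem_graded (hsdeg i x hx) (hsdeg j y hy))
        (hsdeg _ _ (SetLike.mul_mem_graded hx hy))
    rw [ha]
    apply hGdeg
    rw [Qmap]
    cases hm : i + j with
    | zero =>
      rw [hm] at hmem
      obtain ⟨u, hu⟩ := hcob x y
      have h0 : s x * s y - s (x * y) = 0 := by
        rw [← hu] at hmem ⊢
        exact map_eq_zero_of_mem_zero 𝒜 d hddeg hmem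
      have hq0 : q 0 = 0 := by simpa using hqsmul 0 0 ⟨0, map_zero d⟩
      rw [h0, hq0]
      exact Submodule.zero_mem _
    | succ m =>
      rw [hm] at hmem
      exact hqdeg m _ (hcob x y) hmem
  · have hsign : ((-1 : ℤ) ^ i) * (-1) ^ i = 1 := by rw [← mul_pow]; simp
    have hΘ : d (Theta s q i x y z) = 0 := by
      rw [Theta, map_sub, map_add, map_sub, map_smul, hleib i _ (hsdeg i x hx), hs0, zero_mul,
        zero_add, smul_smul, hsign, one_smul, hdmul _ (hs0 z), hdQ, hdQ, hdQ, hdQ, mul_assoc x y z]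
      noncomm_ring
    rw [← hGπ _ hΘ, Theta, map_sub, map_add, map_sub, map_zsmul, hGl, hGr]
    rfl

end Graded

section AlternatingKernel

/-- The cochains all of whose homogeneous components have vanishing antisymmetrization on families
of vectors of `b`. -/
def alternatingKernel {A : Type} {n : ℕ} (b : Fin n → A) {C : Type} [Ring C]
    (𝒜 : ℕ → Submodule ℤ C) [GradedAlgebra 𝒜] (φ : ∀ l : ℕ, ↥(𝒜 l) ≃ₗ[ℤ] ((Fin l → A) → ℤ)) :
    AddSubgroup C where
  carrier := {x | ∀ l, altCoords b l (φ l (DirectSum.decompose 𝒜 x l)) = 0}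
  zero_mem' l := by simp
  add_mem' hx hy l := by
    rw [DirectSum.decompose_add, DirectSum.add_apply, map_add, map_add, hx, hy, add_zero]
  neg_mem' hx l := by
    rw [DirectSum.decompose_neg, DFinsupp.neg_apply, map_neg, map_neg, hx, neg_zero]

variable {A : Type} {n : ℕ} {b : Fin n → A} {C : Type} [Ring C]
    {𝒜 : ℕ → Submodule ℤ C} [GradedAlgebra 𝒜] {φ : ∀ l : ℕ, ↥(𝒜 l) ≃ₗ[ℤ] ((Fin l → A) → ℤ)}

theorem mem_alternatingKernel_of_homogeneous {m : ℕ} (x : 𝒜 m) :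
    (x : C) ∈ alternatingKernel b 𝒜 φ ↔ altCoords b m (φ m x) = 0 := by
  constructor
  · intro h
    have := h m
    rwa [DirectSum.decompose_coe, DirectSum.of_eq_same] at this
  · intro h l
    rw [DirectSum.decompose_coe]
    by_cases hl : m = l
    · subst hl
      rwa [DirectSum.of_eq_same]
    · rw [DirectSum.of_eq_of_ne _ _ _ (Ne.symm hl), map_zero, map_zero]

theorem antisymmetrize_eq_zero_of_altCoords {m : ℕ} {f : (Fin m → A) → ℤ}
    (hf : altCoords b m f = 0) (v : Fin m → Fin n) : antisymmetrize f (b ∘ v) = 0 :=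
  antisymmetrize_eq_zero_of_orderEmbOfFin b (fun S ↦ congrFun hf S) v

theorem mul_mem_alternatingKernel_left
    (hφmul : ∀ (p q : ℕ) (x : ↥(𝒜 p)) (y : ↥(𝒜 q)),
      φ (p + q) ⟨(x : C) * (y : C), SetLike.mul_mem_graded x.2 y.2⟩
        = barCup A p q (φ p x) (φ q y))
    (x : C) {y : C} (hy : y ∈ alternatingKernel b 𝒜 φ) : x * y ∈ alternatingKernel b 𝒜 φ := by
  classical
  rw [← DirectSum.sum_support_decompose 𝒜 x, ← DirectSum.sum_support_decompose 𝒜 y,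
    Finset.sum_mul_sum]
  refine sum_mem fun i _ ↦ sum_mem fun j _ ↦ ?_
  refine (mem_alternatingKernel_of_homogeneous (⟨_, SetLike.mul_mem_graded
    (DirectSum.decompose 𝒜 x i).2 (DirectSum.decompose 𝒜 y j).2⟩ : 𝒜 (i + j))).2 ?_
  rw [hφmul]
  exact funext fun S ↦ antisymmetrize_barCup_of_right b _
    (antisymmetrize_eq_zero_of_altCoords (hy j)) _

theorem mul_mem_alternatingKernel_right
    (hφmul : ∀ (p q : ℕ) (x : ↥(𝒜 p)) (y : ↥(𝒜 q)),
      φ (p + q) ⟨(x : C) * (y : C), SetLike.mul_mem_graded x.2 y.2⟩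
        = barCup A p q (φ p x) (φ q y))
    {x : C} (hx : x ∈ alternatingKernel b 𝒜 φ) (y : C) : x * y ∈ alternatingKernel b 𝒜 φ := by
  classical
  rw [← DirectSum.sum_support_decompose 𝒜 x, ← DirectSum.sum_support_decompose 𝒜 y,
    Finset.sum_mul_sum]
  refine sum_mem fun i _ ↦ sum_mem fun j _ ↦ ?_
  refine (mem_alternatingKernel_of_homogeneous (⟨_, SetLike.mul_mem_graded
    (DirectSum.decompose 𝒜 x i).2 (DirectSum.decompose 𝒜 y j).2⟩ : 𝒜 (i + j))).2 ?_
  rw [hφmul]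
  exact funext fun S ↦ antisymmetrize_barCup_of_left b _
    (antisymmetrize_eq_zero_of_altCoords (hx i)) _

theorem exists_cocycle_sub_mem_alternatingKernel [AddCommGroup A] {b : Module.Basis (Fin n) ℤ A}
    {d : C →ₗ[ℤ] C} (hddeg : ∀ (i : ℕ), ∀ x ∈ 𝒜 i, d x ∈ 𝒜 (i + 1))
    (hφd : ∀ (l : ℕ) (x : ↥(𝒜 l)), φ (l + 1) ⟨d (x : C), hddeg l x x.2⟩ = barDiff A l (φ l x))
    (m : ℕ) (x : C) (hx : x ∈ 𝒜 m) :
    ∃ z ∈ 𝒜 m, d z = 0 ∧ x - z ∈ alternatingKernel b 𝒜 φ := by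
  obtain ⟨z, hz, hzx⟩ := exists_cocycle_altCoords_eq b m (altCoords b m (φ m ⟨x, hx⟩))
  refine ⟨(φ m).symm z, Subtype.prop _, ?_, ?_⟩
  · have h := hφd m ((φ m).symm z)
    rw [LinearEquiv.apply_symm_apply, hz, LinearEquiv.map_eq_zero_iff] at h
    exact congrArg Subtype.val h
  · refine (mem_alternatingKernel_of_homogeneous (⟨x, hx⟩ - (φ m).symm z)).2 ?_
    rw [map_sub, map_sub, LinearEquiv.apply_symm_apply, hzx, sub_self]

theorem exists_map_eq_of_mem_alternatingKernel [AddCommGroup A] {b : Module.Basis (Fin n) ℤ A}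
    {d : C →ₗ[ℤ] C} (hddeg : ∀ (i : ℕ), ∀ x ∈ 𝒜 i, d x ∈ 𝒜 (i + 1))
    (hφd : ∀ (l : ℕ) (x : ↥(𝒜 l)), φ (l + 1) ⟨d (x : C), hddeg l x x.2⟩ = barDiff A l (φ l x))
    {z : C} (hz : z ∈ alternatingKernel b 𝒜 φ) (hdz : d z = 0) : ∃ y, d y = z := by
  have h (l : ℕ) : ∃ y, d y = DirectSum.decompose 𝒜 z l := by
    have hl := hz l
    cases l with
    | zero =>
      refine ⟨0, ?_⟩
      have h0 : φ 0 (DirectSum.decompose 𝒜 z 0) = 0 := by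
        funext a
        have := congrFun hl ⟨∅, rfl⟩
        simpa [altCoords, antisymmetrize, Subsingleton.elim _ a] using this
      rw [LinearEquiv.map_eq_zero_iff] at h0
      rw [h0, map_zero, ZeroMemClass.coe_zero]
    | succ l =>
      have hc : barDiff A (l + 1) (φ (l + 1) (DirectSum.decompose 𝒜 z (l + 1))) = 0 := by
        rw [← hφd, LinearEquiv.map_eq_zero_iff]
        apply Subtype.ext
        simp [← decompose_map_succ 𝒜 d hddeg, hdz]
      obtain ⟨y, hy⟩ := exists_barDiff_eq_of_altCoords_eq_zero b l hc hl
      refine ⟨(φ l).symm y, ?_⟩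
      have h := hφd l ((φ l).symm y)
      rw [LinearEquiv.apply_symm_apply, hy] at h
      exact congrArg Subtype.val ((φ (l + 1)).injective h)
  choose y hy using h
  classical
  refine ⟨∑ l ∈ (DirectSum.decompose 𝒜 z).support, y l, ?_⟩
  rw [map_sum, Finset.sum_congr rfl fun l _ ↦ hy l, DirectSum.sum_support_decompose]

end AlternatingKernel

/-- **Triviality of the canonical class for a torus.** Let `A` be a finitely generated
free abelian group and let `C` be (a dg-algebra isomorphic to) its standard bar cochain
dg-algebra over `ℤ`, with cohomology ring `H = H^*(A)`.  Then the canonical Hochschild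
3-cocycle `θ` of `H^*(A)` is a Hochschild coboundary; equivalently, the class
`[θ(A)] ∈ HH³_gr(H^*(A), H^*(A)-bar[1])` is trivial. -/
theorem torus_theta_class_trivial
    (A : Type) [AddCommGroup A] [Module.Free ℤ A] [Module.Finite ℤ A]
    (C : Type) [Ring C]
    (𝒜 : ℕ → Submodule ℤ C) [GradedAlgebra 𝒜]
    (d : C →ₗ[ℤ] C)
    (hd2 : ∀ x : C, d (d x) = 0)
    (hddeg : ∀ (i : ℕ), ∀ x ∈ 𝒜 i, d x ∈ 𝒜 (i + 1))
    (hleib : ∀ (i : ℕ), ∀ x ∈ 𝒜 i, ∀ y : C,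
      d (x * y) = d x * y + ((-1 : ℤ) ^ i) • (x * d y))
    -- `C` is the bar cochain dg-algebra of `A`
    (φ : ∀ l : ℕ, ↥(𝒜 l) ≃ₗ[ℤ] ((Fin l → A) → ℤ))
    (hφmul : ∀ (p q : ℕ) (x : ↥(𝒜 p)) (y : ↥(𝒜 q)),
      φ (p + q) ⟨(x : C) * (y : C), SetLike.mul_mem_graded x.2 y.2⟩
        = barCup A p q (φ p x) (φ q y))
    (hφd : ∀ (l : ℕ) (x : ↥(𝒜 l)),
      φ (l + 1) ⟨d (x : C), hddeg l x x.2⟩ = barDiff A l (φ l x))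
    (hφone : φ 0 ⟨(1 : C), SetLike.one_mem_graded 𝒜⟩ = fun _ => 1)
    (H : Type) [Ring H]
    (ℋ : ℕ → Submodule ℤ H) [GradedAlgebra ℋ]
    (π : C → H)
    (hπadd : ∀ x y : C, d x = 0 → d y = 0 → π (x + y) = π x + π y)
    (hπsmul : ∀ (a : ℤ) (x : C), d x = 0 → π (a • x) = a • π x)
    (hπmul : ∀ x y : C, d x = 0 → d y = 0 → π (x * y) = π x * π y)
    (hπone : π 1 = 1)
    (hπdeg : ∀ (i : ℕ), ∀ x ∈ 𝒜 i, d x = 0 → π x ∈ ℋ i)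
    (hπker : ∀ x : C, d x = 0 → (π x = 0 ↔ ∃ y : C, d y = x))
    (hπsurj : ∀ h : H, ∃ x : C, d x = 0 ∧ π x = h)
    (s : H →ₗ[ℤ] C)
    (hs0 : ∀ h : H, d (s h) = 0)
    (hsπ : ∀ h : H, π (s h) = h)
    (hsdeg : ∀ (i : ℕ), ∀ h ∈ ℋ i, s h ∈ 𝒜 i)
    (q : C → C)
    (hqd : ∀ x : C, (∃ y, d y = x) → d (q x) = x)
    (hqadd : ∀ x y : C, (∃ u, d u = x) → (∃ v, d v = y) → q (x + y) = q x + q y)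
    (hqsmul : ∀ (a : ℤ) (x : C), (∃ y, d y = x) → q (a • x) = a • q x)
    (hqdeg : ∀ (i : ℕ), ∀ x : C, (∃ y, d y = x) → x ∈ 𝒜 (i + 1) → q x ∈ 𝒜 i) :
    ∃ a : H →ₗ[ℤ] H →ₗ[ℤ] H,
      (∀ (i j : ℕ), ∀ x ∈ ℋ i, ∀ y ∈ ℋ j, a x y ∈ ℋ (i + j - 1)) ∧
      ∀ (i j l : ℕ) (x y z : H), x ∈ ℋ i → y ∈ ℋ j → z ∈ ℋ l →
        π (Theta s q i x y z)
          = ((-1 : ℤ) ^ i) • (x * a y z) - a (x * y) z + a x (y * z) - a x y * z := by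
  exact exists_coboundary_of_ideal 𝒜 d hddeg hleib ℋ π hπadd hπmul hπdeg hπker s hs0 hsπ hsdeg q hqd
    hqadd hqsmul hqdeg (alternatingKernel (Module.finBasis ℤ A) 𝒜 φ)
    (fun _ ↦ exists_map_eq_of_mem_alternatingKernel hddeg hφd)
    (exists_cocycle_sub_mem_alternatingKernel hddeg hφd)
    (fun x _ ↦ mul_mem_alternatingKernel_left hφmul x)
    (fun _ hx y ↦ mul_mem_alternatingKernel_right hφmul hx y)
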